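/- arXiv:1603.00945 — 2 statements merged into one kernel-verified Lean document; each statement's English description precedes it below -/
import Mathlib

section
/- Let α > −1/2 and n ∈ ℤ⁺, let x_{n,0}^{(α)} < ⋯ < x_{n,n}^{(α)} be the Gegenbauer–Gauss points with Christoffel numbers ϖ_{n,i}^{(α)}, and for each i let ξ_{n,i}^{(α)} = 1/∏_{j≠i} (x_{n,i}^{(α)} − x_{n,j}^{(α)}) be the barycentric weights. Then each ϖ_{n,i}^{(α)} > 0 and there exists a nonzero real constant c, independent of i, such that ξ_{n,i}^{(α)} = c · (−1)^i · √((1 − (x_{n,i}^{(α)})²) · ϖ_{n,i}^{(α)}) for every i = 0, …, n. -/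
open Polynomial in
theorem gegenbauer_derivative_relations {α : ℝ} (hα : -1 / 2 < α) {G : ℕ → ℝ[X]}
    (hG0 : G 0 = 1) (hG1 : G 1 = X)
    (hGrec : ∀ k : ℕ, 1 ≤ k →
      C ((k : ℝ) + 2 * α) * G (k + 1) =
        C (2 * ((k : ℝ) + α)) * (X * G k) - C (k : ℝ) * G (k - 1)) (k : ℕ) :
    (1 - X ^ 2) * derivative (G (k + 1)) = C ((k : ℝ) + 1) * (G k - X * G (k + 1)) ∧
      (1 - X ^ 2) * derivative (G k) = C ((k : ℝ) + 2 * α) * (X * G k - G (k + 1)) := by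
  induction k with
  | zero => simp [hG0, hG1, sq]
  | succ k ih =>
    obtain ⟨ihA, ihB⟩ := ih
    have hrec := hGrec (k + 1) (by omega)
    have hder := congrArg derivative hrec
    simp only [Nat.add_sub_cancel, derivative_sub, derivative_mul, derivative_C, derivative_X,
      zero_mul, zero_add, one_mul] at hrec hder
    have hne : (C (((k + 1 : ℕ) : ℝ) + 2 * α) : ℝ[X]) ≠ 0 := by
      rw [Ne, C_eq_zero]
      push_cast
      have : (0 : ℝ) ≤ k := k.cast_nonneg
      linarith
    have h2 : (C 2 : ℝ[X]) = 2 := rfl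
    simp only [Nat.cast_add, Nat.cast_one, C_add, C_mul, C_1, h2] at hrec hder hne ihA ihB ⊢
    constructor
    · apply mul_left_cancel₀ hne
      linear_combination (1 - X ^ 2) * hder + 2 * (C (k : ℝ) + 1 + C α) * X * ihA
        - (C (k : ℝ) + 1) * ihB + (C (k : ℝ) + 2) * X * hrec
    · linear_combination ihA + hrec

open Polynomial in
/-- The Gegenbauer differential equation. -/
theorem gegenbauer_differential_equation {α : ℝ} (hα : -1 / 2 < α) {G : ℕ → ℝ[X]}
    (hG0 : G 0 = 1) (hG1 : G 1 = X)
    (hGrec : ∀ k : ℕ, 1 ≤ k →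
      C ((k : ℝ) + 2 * α) * G (k + 1) =
        C (2 * ((k : ℝ) + α)) * (X * G k) - C (k : ℝ) * G (k - 1)) (k : ℕ) :
    (1 - X ^ 2) * derivative (derivative (G (k + 1))) -
        C (2 * α + 1) * X * derivative (G (k + 1)) =
      -C (((k : ℝ) + 1) * (k + 1 + 2 * α)) * G (k + 1) := by
  obtain ⟨hA, hB⟩ := gegenbauer_derivative_relations hα hG0 hG1 hGrec k
  have hder := congrArg derivative hA
  have hne : (1 - X ^ 2 : ℝ[X]) ≠ 0 := fun h => by
    have := congrArg (eval 0) h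
    simp at this
  simp only [derivative_sub, derivative_mul, derivative_C, derivative_X, derivative_one,
    derivative_X_sq, zero_mul, zero_add, zero_sub, one_mul] at hder
  apply mul_left_cancel₀ hne
  simp only [C_add, C_mul, C_1] at *
  have h2 : (C 2 : ℝ[X]) = 2 := rfl
  simp only [h2] at *
  linear_combination (1 - X ^ 2) * hder + (1 - 2 * C α - C (k : ℝ) - 1) * X * hA
    + (C (k : ℝ) + 1) * hB

open Polynomial in
theorem gegenbauer_natDegree_le {α : ℝ} (hα : -1 / 2 < α) {G : ℕ → ℝ[X]}
    (hG0 : G 0 = 1) (hG1 : G 1 = X)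
    (hGrec : ∀ k : ℕ, 1 ≤ k →
      C ((k : ℝ) + 2 * α) * G (k + 1) =
        C (2 * ((k : ℝ) + α)) * (X * G k) - C (k : ℝ) * G (k - 1)) (k : ℕ) :
    (G k).natDegree ≤ k := by
  induction k using Nat.strong_induction_on with
  | _ k ih =>
    match k with
    | 0 => simp [hG0]
    | 1 => simp [hG1]
    | m + 2 =>
      have hne : ((m + 1 : ℕ) : ℝ) + 2 * α ≠ 0 := by
        push_cast
        have : (0 : ℝ) ≤ m := m.cast_nonneg
        linarith
      rw [← natDegree_C_mul hne, hGrec (m + 1) (by omega)]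
      refine (natDegree_sub_le _ _).trans (max_le ?_ ?_)
      · refine (natDegree_C_mul_le _ _).trans (natDegree_mul_le.trans ?_)
        have := ih (m + 1) (by omega)
        simp only [natDegree_X]
        omega
      · refine (natDegree_C_mul_le _ _).trans ?_
        have := ih m (by omega)
        simpa using this.trans (by omega)

open Polynomial in
/-- A linear functional vanishing on the products of `p` with `X ^ m`, `m < n`, vanishes on the
products of `p` with all polynomials of degree less than `n`. -/
theorem map_mul_eq_zero_of_natDegree_lt {Λ : ℝ[X] →ₗ[ℝ] ℝ} {p : ℝ[X]} {n : ℕ}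
    (h : ∀ m < n, Λ (p * X ^ m) = 0) {f : ℝ[X]} (hf : f.degree < n) : Λ (p * f) = 0 := by
  by_cases h0 : f = 0
  · simp [h0]
  rw [← natDegree_lt_iff_degree_lt h0] at hf
  rw [f.as_sum_range_C_mul_X_pow' hf, Finset.mul_sum, map_sum]
  refine Finset.sum_eq_zero fun m hm => ?_
  rw [mul_left_comm, ← smul_eq_C_mul, map_smul, h m (Finset.mem_range.1 hm), smul_zero]

open Polynomial in
/-- Green identity for the Gegenbauer differential operator. -/
theorem map_derivative_mul_derivative {Λ : ℝ[X] →ₗ[ℝ] ℝ} {a lam : ℝ}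
    (hΛ : ∀ f, Λ ((1 - X ^ 2) * derivative f - C a * X * f) = 0) {p : ℝ[X]}
    (hp : (1 - X ^ 2) * derivative (derivative p) - C a * X * derivative p = -C lam * p)
    (r : ℝ[X]) :
    Λ ((1 - X ^ 2) * derivative p * derivative r) = lam * Λ (p * r) := by
  have h := hΛ (derivative p * r)
  rw [derivative_mul, show (1 - X ^ 2) * (derivative (derivative p) * r + derivative p *
    derivative r) - C a * X * (derivative p * r) =
      (1 - X ^ 2) * derivative p * derivative r - C lam * (p * r) by
        linear_combination r * hp, map_sub, ← smul_eq_C_mul, map_smul, smul_eq_mul] at h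
  linarith

open Polynomial in
/-- The Gegenbauer differential operator is symmetric, tested on an eigenfunction `p`. -/
theorem map_mul_differential_operator {Λ : ℝ[X] →ₗ[ℝ] ℝ} {a lam : ℝ}
    (hΛ : ∀ f, Λ ((1 - X ^ 2) * derivative f - C a * X * f) = 0) {p : ℝ[X]}
    (hp : (1 - X ^ 2) * derivative (derivative p) - C a * X * derivative p = -C lam * p)
    (r : ℝ[X]) :
    Λ (p * ((1 - X ^ 2) * derivative (derivative r) - C a * X * derivative r + C lam * r)) = 0 := by
  have h1 := map_derivative_mul_derivative hΛ hp r
  have h2 := hΛ (p * derivative r)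
  rw [derivative_mul] at h2
  have h3 : p * ((1 - X ^ 2) * derivative (derivative r) - C a * X * derivative r + C lam * r) =
      ((1 - X ^ 2) * (derivative p * derivative r + p * derivative (derivative r)) -
        C a * X * (p * derivative r)) - (1 - X ^ 2) * derivative p * derivative r +
        lam • (p * r) := by
    rw [smul_eq_C_mul]
    ring
  rw [h3, map_add, map_sub, h1, h2, map_smul, smul_eq_mul]
  ring

open Polynomial in
theorem differential_operator_X_pow (a lam : ℝ) (m : ℕ) :
    (1 - X ^ 2) * derivative (derivative (X ^ m)) - C a * X * derivative (X ^ m) +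
        C lam * X ^ m =
      C (lam - m * (m - 1 + a)) * X ^ m + C ((m : ℝ) * (m - 1)) * X ^ (m - 2) := by
  rcases m with _ | _ | k
  · simp
  · simp only [zero_add, pow_one, derivative_X, derivative_one, Nat.cast_one, C_sub, C_add,
      C_mul, C_1]
    ring
  · have h : derivative (X ^ (k + 1 + 1) : ℝ[X]) = (C (k : ℝ) + 2) * X ^ (k + 1) := by
      rw [derivative_X_pow_succ]
      push_cast
      simp only [C_add, C_1]
      ring
    have h' : derivative ((C (k : ℝ) + 2) * X ^ (k + 1) : ℝ[X]) =
        (C (k : ℝ) + 2) * ((C (k : ℝ) + 1) * X ^ k) := by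
      have h2 : (2 : ℝ[X]) = C 2 := rfl
      rw [h2, ← C_add, derivative_C_mul, derivative_X_pow_succ, C_add, C_add, C_1]
    rw [h, h', show k + 1 + 1 - 2 = k by omega]
    push_cast
    simp only [C_sub, C_add, C_mul, C_1]
    ring

open Polynomial in
theorem map_mul_X_pow_eq_zero {Λ : ℝ[X] →ₗ[ℝ] ℝ} {α : ℝ} (hα : -1 / 2 < α)
    (hΛ : ∀ f, Λ ((1 - X ^ 2) * derivative f - C (2 * α + 1) * X * f) = 0) {p : ℝ[X]} {N : ℕ}
    (hp : (1 - X ^ 2) * derivative (derivative p) - C (2 * α + 1) * X * derivative p =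
      -C ((N : ℝ) * (N + 2 * α)) * p) (m : ℕ) (hm : m < N) :
    Λ (p * X ^ m) = 0 := by
  induction m using Nat.strong_induction_on with
  | _ m ih =>
    have h1 := map_mul_differential_operator hΛ hp (X ^ m)
    have h2 : ((m : ℝ) * (m - 1)) * Λ (p * X ^ (m - 2)) = 0 := by
      rcases Nat.lt_or_ge m 2 with h | h
      · interval_cases m <;> simp
      · rw [ih (m - 2) (by omega) (by omega), mul_zero]
    rw [differential_operator_X_pow, mul_add, mul_left_comm, mul_left_comm p, map_add,
      ← smul_eq_C_mul, ← smul_eq_C_mul, map_smul, map_smul, smul_eq_mul, smul_eq_mul, h2,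
      add_zero] at h1
    refine (mul_eq_zero.1 h1).resolve_left ?_
    have hm' : (m : ℝ) + 1 ≤ N := by exact_mod_cast hm
    have hm0 : (0 : ℝ) ≤ m := m.cast_nonneg
    have hfac : (N : ℝ) * (N + 2 * α) - m * (m - 1 + (2 * α + 1)) =
        (N - m) * (N + m + 2 * α) := by ring
    rw [hfac]
    exact (mul_pos (by linarith) (by linarith)).ne'

open MeasureTheory in
theorem intervalIntegrable_one_sub_sq_rpow {β : ℝ} (hβ : -1 < β) :
    IntervalIntegrable (fun t : ℝ => (1 - t ^ 2) ^ β) volume (-1) 1 := by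
  have left : IntervalIntegrable (fun t : ℝ => (1 - t ^ 2) ^ β) volume (-1) 0 := by
    have h : IntervalIntegrable (fun t : ℝ => (t + 1) ^ β) volume (-1) 0 := by
      simpa using (intervalIntegral.intervalIntegrable_rpow' (a := 0) (b := 1) hβ).comp_add_right 1
    have hc : ContinuousOn (fun t : ℝ => (1 - t) ^ β) (Set.uIcc (-1) 0) := by
      refine ContinuousOn.rpow_const (by fun_prop) fun t ht => Or.inl ?_
      rw [Set.uIcc_of_le (by norm_num)] at ht
      linarith [ht.2]
    refine (h.mul_continuousOn hc).congr fun t ht => ?_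
    rw [Set.uIoc_of_le (by norm_num)] at ht
    rw [← Real.mul_rpow (by linarith [ht.1]) (by linarith [ht.2])]
    congr 1
    ring
  refine left.trans ?_
  simpa using (left.comp_sub_left 0).symm

open Polynomial MeasureTheory in
theorem intervalIntegrable_eval_mul_one_sub_sq_rpow {β : ℝ} (hβ : -1 < β) (f : ℝ[X]) :
    IntervalIntegrable (fun t : ℝ => f.eval t * (1 - t ^ 2) ^ β) volume (-1) 1 :=
  (intervalIntegrable_one_sub_sq_rpow hβ).continuousOn_mul f.continuous.continuousOn

open Polynomial in
/-- Integration of polynomials against the weight `(1 - t ^ 2) ^ β` on `[-1, 1]`. -/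
noncomputable def weightedIntegral {β : ℝ} (hβ : -1 < β) : ℝ[X] →ₗ[ℝ] ℝ where
  toFun f := ∫ t in (-1 : ℝ)..1, f.eval t * (1 - t ^ 2) ^ β
  map_add' f g := by
    simp only [eval_add, add_mul]
    exact intervalIntegral.integral_add (intervalIntegrable_eval_mul_one_sub_sq_rpow hβ f)
      (intervalIntegrable_eval_mul_one_sub_sq_rpow hβ g)
  map_smul' c f := by
    simp [mul_assoc]

open Polynomial MeasureTheory in
theorem weightedIntegral_integration_by_parts {α : ℝ} (hα : -1 < α - 1 / 2) (f : ℝ[X]) :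
    weightedIntegral hα ((1 - X ^ 2) * derivative f - C (2 * α + 1) * X * f) = 0 := by
  have hderiv : ∀ t ∈ Set.Ioo (-1 : ℝ) 1,
      HasDerivAt (fun t : ℝ => f.eval t * (1 - t ^ 2) ^ (α + 1 / 2))
        (((1 - X ^ 2) * derivative f - C (2 * α + 1) * X * f).eval t *
          (1 - t ^ 2) ^ (α - 1 / 2)) t := by
    intro t ht
    have hpos : 0 < 1 - t ^ 2 := by nlinarith [ht.1, ht.2]
    have hd : HasDerivAt (fun t : ℝ => 1 - t ^ 2) (-(2 * t)) t := by
      simpa using (hasDerivAt_pow 2 t).const_sub 1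
    have hd' := (f.hasDerivAt t).mul (hd.rpow_const (p := α + 1 / 2) (Or.inl hpos.ne'))
    refine hd'.congr_deriv ?_
    rw [show α + 1 / 2 - 1 = α - 1 / 2 by ring, show α + 1 / 2 = α - 1 / 2 + 1 by ring,
      Real.rpow_add_one hpos.ne']
    simp only [eval_sub, eval_mul, eval_one, eval_pow, eval_X, eval_C]
    ring
  refine (intervalIntegral.integral_eq_sub_of_hasDerivAt_of_le (by norm_num)
    (f.continuous.continuousOn.mul
      (ContinuousOn.rpow_const (by fun_prop) fun t _ => Or.inr (by linarith)))
    hderiv (intervalIntegrable_eval_mul_one_sub_sq_rpow hα _)).trans ?_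
  have h0 : (0 : ℝ) ^ (α + 1 / 2) = 0 := Real.zero_rpow (by linarith)
  rw [Pi.mul_apply, Pi.mul_apply, show (1 : ℝ) - 1 ^ 2 = 0 by norm_num,
    show (1 : ℝ) - (-1) ^ 2 = 0 by norm_num, h0]
  ring

open Polynomial MeasureTheory in
theorem weightedIntegral_mul_self_pos {β : ℝ} (hβ : -1 < β) {f : ℝ[X]} (hf : f ≠ 0) :
    0 < weightedIntegral hβ (f * f) := by
  change 0 < ∫ t in (-1 : ℝ)..1, (f * f).eval t * (1 - t ^ 2) ^ β
  have hsub : Set.Ioo (-1 : ℝ) 1 \ (f.roots.toFinset : Set ℝ) ⊆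
      Function.support (fun t : ℝ => (f * f).eval t * (1 - t ^ 2) ^ β) ∩ Set.Ioc (-1) 1 := by
    rintro t ⟨ht, hroot⟩
    refine ⟨?_, ht.1, ht.2.le⟩
    have hpos : 0 < 1 - t ^ 2 := by nlinarith [ht.1, ht.2]
    have hne : f.eval t ≠ 0 := by simpa [hf] using hroot
    simp [hne, (Real.rpow_pos_of_pos hpos β).ne']
  rw [intervalIntegral.integral_pos_iff_support_of_nonneg_ae' ?_
    (intervalIntegrable_eval_mul_one_sub_sq_rpow hβ _)]
  · refine ⟨by norm_num, lt_of_lt_of_le ?_ (measure_mono hsub)⟩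
    rw [measure_sdiff_null (Finset.measure_zero _ _)]
    simp
  · rw [Set.uIoc_of_le (by norm_num)]
    refine (ae_restrict_iff' measurableSet_Ioc).2 (Filter.Eventually.of_forall fun t ht => ?_)
    have hpos : 0 ≤ 1 - t ^ 2 := by nlinarith [ht.1, ht.2]
    simp only [Pi.zero_apply, eval_mul]
    exact mul_nonneg (mul_self_nonneg _) (Real.rpow_nonneg hpos β)

/-- The sign of the denominators of the barycentric weights of an increasing family of nodes. -/
theorem neg_one_pow_mul_prod_sub_pos {n : ℕ} {x : Fin (n + 1) → ℝ} (hx : StrictMono x)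
    (i : Fin (n + 1)) :
    0 < (-1 : ℝ) ^ (n + i : ℕ) * ∏ j ∈ Finset.univ.erase i, (x i - x j) := by
  have hset : (Finset.univ.erase i).filter (fun j => i < j) = Finset.Ioi i := by
    ext j
    simp only [Finset.mem_filter, Finset.mem_erase, Finset.mem_univ, and_true, Finset.mem_Ioi]
    exact ⟨And.right, fun h => ⟨h.ne', h⟩⟩
  have hprod : ∏ j ∈ Finset.univ.erase i, (x i - x j) =
      (-1) ^ (n - i : ℕ) * ∏ j ∈ Finset.univ.erase i, |x i - x j| := by
    have hfac : ∀ j ∈ Finset.univ.erase i, x i - x j =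
        (if i < j then -1 else 1) * |x i - x j| := by
      intro j _
      split_ifs with h
      · rw [abs_of_neg (sub_neg.2 (hx h))]
        ring
      · rw [abs_of_nonneg (sub_nonneg.2 (hx.monotone (not_lt.1 h))), one_mul]
    rw [Finset.prod_congr rfl hfac, Finset.prod_mul_distrib, Finset.prod_ite, hset]
    simp
  rw [hprod, ← mul_assoc, ← pow_add, Even.neg_one_pow, one_mul]
  · exact Finset.prod_pos fun j hj => abs_pos.2
      (sub_ne_zero.2 fun h => (Finset.mem_erase.1 hj).1 (hx.injective h).symm)
  · exact ⟨n, by omega⟩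

open Polynomial in
theorem exists_eq_C_mul_nodal {n : ℕ} {x : Fin (n + 1) → ℝ} (hx : Function.Injective x) {f : ℝ[X]}
    (hdeg : f.natDegree ≤ n + 1) (hroot : ∀ i, f.eval (x i) = 0) :
    ∃ c : ℝ, f = C c * Lagrange.nodal Finset.univ x := by
  have hdvd : Lagrange.nodal Finset.univ x ∣ f :=
    Finset.prod_dvd_of_coprime
      (fun i _ j _ hij => pairwise_coprime_X_sub_C hx hij)
      fun i _ => dvd_iff_isRoot.2 (hroot i)
  obtain ⟨g, hg⟩ := hdvd
  by_cases h0 : g = 0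
  · exact ⟨0, by simp [hg, h0]⟩
  have hgd : g.natDegree = 0 := by
    have := (Lagrange.nodal_monic (s := Finset.univ) (v := x)).natDegree_mul' h0
    rw [← hg, Lagrange.natDegree_nodal] at this
    simp at this
    omega
  exact ⟨g.coeff 0, by rw [← eq_C_of_natDegree_eq_zero hgd, hg, mul_comm]⟩

open Polynomial in
/-- For a functional `Λ` orthogonal to `(X - a) * q` in degree less than that of `q`, the product
`f * q` with `f` of at most the degree of `q` only depends on `f` through its value at `a`. -/
theorem map_mul_eq_eval_mul {Λ : ℝ[X] →ₗ[ℝ] ℝ} {n : ℕ} {a : ℝ} {q : ℝ[X]}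
    (hq : ∀ f : ℝ[X], f.degree < (n + 1 : ℕ) → Λ ((X - C a) * q * f) = 0) {f : ℝ[X]}
    (hf : f.degree < (n + 1 : ℕ)) :
    Λ (f * q) = f.eval a * Λ q := by
  have h := hq (f /ₘ (X - C a)) ((degree_divByMonic_le _ _).trans_lt hf)
  have hdecomp : f * q = (X - C a) * q * (f /ₘ (X - C a)) + C (f.eval a) * q := by
    nth_rw 1 [← modByMonic_add_div f (X - C a)]
    rw [modByMonic_X_sub_C_eq_C_eval]
    ring
  rw [hdecomp, map_add, h, zero_add, ← smul_eq_C_mul, map_smul, smul_eq_mul]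

open Polynomial in

/-- **Explicit barycentric weights for the Gegenbauer–Gauss points.**
For `α > -1/2` and `n ∈ ℤ⁺`, letting `x 0 < ⋯ < x n` be the Gegenbauer–Gauss points
(the zeros of the standardized Gegenbauer polynomial `G (n+1)`), `w i` the corresponding
Christoffel numbers and `ξ i = 1 / ∏_{j ≠ i} (x i - x j)` the barycentric weights, every
`w i` is positive and there is a nonzero constant `c`, independent of `i`, with
`ξ i = c * (-1)^i * √((1 - (x i)^2) * w i)` for all `i`. -/
theorem barycentric_weights_GG_sqrt_form
    (α : ℝ) (hα : -1/2 < α) (n : ℕ) (hn : 1 ≤ n)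
    (G : ℕ → Polynomial ℝ)
    (hG0 : G 0 = 1) (hG1 : G 1 = Polynomial.X)
    (hGrec : ∀ k : ℕ, 1 ≤ k →
      Polynomial.C ((k : ℝ) + 2 * α) * G (k + 1) =
        Polynomial.C (2 * ((k : ℝ) + α)) * (Polynomial.X * G k) -
          Polynomial.C (k : ℝ) * G (k - 1))
    (x : Fin (n + 1) → ℝ)
    (hx_mono : StrictMono x)
    (hx_mem : ∀ i, x i ∈ Set.Ioo (-1 : ℝ) 1)
    (hx_root : ∀ y : ℝ, (G (n + 1)).eval y = 0 ↔ ∃ i, y = x i)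
    (L : Fin (n + 1) → Polynomial ℝ)
    (hL_deg : ∀ k, (L k).natDegree ≤ n)
    (hL_eval : ∀ k j, (L k).eval (x j) = if j = k then (1 : ℝ) else 0)
    (w : Fin (n + 1) → ℝ)
    (hw : ∀ k, w k = ∫ t in (-1 : ℝ)..1, (L k).eval t * (1 - t ^ 2) ^ (α - 1/2))
    (ξ : Fin (n + 1) → ℝ)
    (hξ : ∀ i, ξ i = 1 / ∏ j ∈ Finset.univ.erase i, (x i - x j)) :
    (∀ i, 0 < w i) ∧
      ∃ c : ℝ, c ≠ 0 ∧
        ∀ i, ξ i = c * (-1 : ℝ) ^ (i : ℕ) * Real.sqrt ((1 - (x i) ^ 2) * w i) := by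
  have hβ : -1 < α - 1 / 2 := by linarith
  set Λ := weightedIntegral hβ with hΛdef
  have hΛ := weightedIntegral_integration_by_parts hβ
  rw [← hΛdef] at hΛ
  set p := Lagrange.nodal Finset.univ x with hpdef
  set q : Fin (n + 1) → ℝ[X] := fun i => Lagrange.nodal (Finset.univ.erase i) x with hqdef
  have hpq : ∀ i, p = (X - C (x i)) * q i := fun i =>
    Lagrange.nodal_eq_mul_nodal_erase (Finset.mem_univ i)
  have hqmonic : ∀ i, (q i).Monic := fun i => Lagrange.nodal_monic
  have hqdeg : ∀ i, (q i).natDegree = n := fun i => by simp [hqdef, Lagrange.natDegree_nodal]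
  have hpdeg : p.natDegree = n + 1 := by simp [hpdef, Lagrange.natDegree_nodal]
  obtain ⟨c, hc⟩ := exists_eq_C_mul_nodal hx_mono.injective
    (gegenbauer_natDegree_le hα hG0 hG1 hGrec (n + 1)) fun i => (hx_root _).2 ⟨i, rfl⟩
  rw [← hpdef] at hc
  have hc0 : c ≠ 0 := by
    rintro rfl
    obtain ⟨i, hi⟩ := (hx_root 2).1 (by simp [hc])
    linarith [(hx_mem i).2]
  have hode : (1 - X ^ 2) * derivative (derivative p) - C (2 * α + 1) * X * derivative p =
      -C (((n + 1 : ℕ) : ℝ) * ((n + 1 : ℕ) + 2 * α)) * p := by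
    have h := gegenbauer_differential_equation hα hG0 hG1 hGrec n
    rw [hc] at h
    simp only [derivative_C_mul] at h
    apply mul_left_cancel₀ (C_ne_zero.2 hc0)
    push_cast
    linear_combination h
  have hmono := map_mul_X_pow_eq_zero hα hΛ hode
  have horth : ∀ f : ℝ[X], f.degree < (n + 1 : ℕ) → Λ (p * f) = 0 := fun f hf =>
    map_mul_eq_zero_of_natDegree_lt hmono hf
  have horth' : ∀ f : ℝ[X], f.degree < n → Λ ((1 - X ^ 2) * derivative p * f) = 0 := by
    refine fun f hf => map_mul_eq_zero_of_natDegree_lt (fun m hm => ?_) hf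
    have h := map_derivative_mul_derivative hΛ hode (X ^ (m + 1))
    rw [hmono (m + 1) (by omega), mul_zero, derivative_X_pow, mul_left_comm, ← smul_eq_C_mul,
      map_smul, smul_eq_mul] at h
    simpa using (mul_eq_zero.1 h).resolve_left (by positivity)
  set d : Fin (n + 1) → ℝ := fun i => (q i).eval (x i) with hddef
  have hdprod : ∀ i, d i = ∏ j ∈ Finset.univ.erase i, (x i - x j) := fun i =>
    Lagrange.eval_nodal ..
  have hd0 : ∀ i, d i ≠ 0 := fun i h => by
    have := neg_one_pow_mul_prod_sub_pos hx_mono i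
    simp [← hdprod, h] at this
  have hder : ∀ i, (derivative p).eval (x i) = d i := fun i => by
    simp [hpq i, hddef]
  have hdegq : ∀ i, (q i).degree < (n + 1 : ℕ) := fun i => by
    rw [degree_eq_natDegree (hqmonic i).ne_zero, hqdeg]
    exact_mod_cast n.lt_succ_self
  have hdegp' : (derivative p).degree < (n + 1 : ℕ) := by
    rw [← hpdeg, ← degree_eq_natDegree (Lagrange.nodal_monic).ne_zero]
    exact degree_derivative_lt (Lagrange.nodal_monic).ne_zero
  have hdegL : ∀ i, (L i).degree < (n + 1 : ℕ) := fun i =>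
    lt_of_le_of_lt (natDegree_le_iff_degree_le.1 (hL_deg i)) (by exact_mod_cast n.lt_succ_self)
  have hLq : ∀ i, C (d i) * L i = q i := fun i => by
    refine eq_of_degrees_lt_of_eval_index_eq Finset.univ hx_mono.injective.injOn
      (by simpa [degree_C_mul (hd0 i)] using hdegL i) (by simpa using hdegq i) fun j _ => ?_
    rw [eval_mul, eval_C, hL_eval]
    split_ifs with h
    · rw [h, mul_one]
    · rw [mul_zero, Lagrange.eval_nodal_at_node (Finset.mem_erase.2 ⟨h, Finset.mem_univ j⟩)]
  have hwq : ∀ i, Λ (q i) = d i * w i := fun i => by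
    rw [← hLq i, ← smul_eq_C_mul, map_smul, hw i]
    rfl
  have heval : ∀ i, ∀ f : ℝ[X], f.degree < (n + 1 : ℕ) →
      Λ (f * q i) = f.eval (x i) * Λ (q i) := fun i f hf =>
    map_mul_eq_eval_mul (n := n) (fun g hg => by rw [← hpq i]; exact horth g hg) hf
  have hwpos : ∀ i, 0 < w i := fun i => by
    have h1 := weightedIntegral_mul_self_pos hβ (hqmonic i).ne_zero
    rw [← hΛdef, heval i _ (hdegq i), hwq i, ← mul_assoc] at h1
    exact pos_of_mul_pos_right h1 (mul_self_nonneg _)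
  refine ⟨hwpos, ?_⟩
  obtain ⟨K, hK⟩ : ∃ K : ℝ, ∀ i, (1 - x i ^ 2) * w i * d i ^ 2 = K := by
    refine ⟨Λ ((1 - X ^ 2) * derivative p * X ^ n) + Λ (p * (X * derivative p)), fun i => ?_⟩
    have h1 : Λ ((1 - X ^ 2) * derivative p * (q i - X ^ n)) = 0 := by
      refine horth' _ ?_
      have hq : (q i).degree = n := by
        rw [degree_eq_natDegree (hqmonic i).ne_zero, hqdeg]
      rw [← hq]
      exact degree_sub_lt_left (by simp [hq]) (hqmonic i).ne_zero
        (by simp [(hqmonic i).leadingCoeff])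
    have h2 : Λ (p * derivative p) = 0 := horth _ hdegp'
    have h3 := heval i _ hdegp'
    rw [hder, hwq] at h3
    have h4 : C (1 - x i ^ 2) * (derivative p * q i) =
        (1 - X ^ 2) * derivative p * X ^ n + (1 - X ^ 2) * derivative p * (q i - X ^ n) +
          p * (X * derivative p) + C (x i) * (p * derivative p) := by
      simp only [C_sub, C_1, C_pow]
      linear_combination (-X - C (x i)) * derivative p * hpq i
    have h5 := congrArg Λ h4
    rw [map_add, map_add, map_add, ← smul_eq_C_mul, ← smul_eq_C_mul, map_smul, map_smul, h1, h2,
      h3, smul_eq_mul, smul_zero, add_zero, add_zero] at h5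
    linear_combination h5
  have hxpos : ∀ i, 0 < 1 - x i ^ 2 := fun i => by nlinarith [(hx_mem i).1, (hx_mem i).2]
  have hKpos : 0 < K := by
    rw [← hK 0]
    exact mul_pos (mul_pos (hxpos 0) (hwpos 0)) (by have := hd0 0; positivity)
  have hsqrt : 0 < √K := Real.sqrt_pos.2 hKpos
  refine ⟨(-1) ^ n / √K, div_ne_zero (by simp) hsqrt.ne', fun i => ?_⟩
  have hsign := neg_one_pow_mul_prod_sub_pos hx_mono i
  rw [← hdprod] at hsign
  have hval : (1 - x i ^ 2) * w i = (√K / ((-1) ^ (n + i : ℕ) * d i)) ^ 2 := by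
    rw [div_pow, mul_pow, Real.sq_sqrt hKpos.le, ← pow_mul, mul_comm _ 2, pow_mul, neg_one_sq,
      one_pow, one_mul, eq_div_iff (pow_ne_zero 2 (hd0 i)), hK]
  rw [hval, Real.sqrt_sq (div_pos hsqrt hsign).le, hξ, ← hdprod, pow_add]
  have := hd0 i
  field_simp
end

section
/- Let −1/2 < α < 0, let n ∈ ℤ⁺ be odd, let x_{n,0}^{(α)} < ⋯ < x_{n,n}^{(α)} be the Gegenbauer–Gauss points with Lagrange basis polynomials ℒ_{n,i}^{(α)}, and set p_{B,j,i} = ∫_{−1}^{x_{n,j}^{(α)}} ℒ_{n,i}^{(α)}(x) dx. If f ∈ C^{n+1}[−1, 1] with ‖f^{(n+1)}‖_{L^∞[−1,1]} ≤ A for some A > 0, then for every j ∈ {0, …, n}: |∫_{−1}^{x_{n,j}^{(α)}} f(x) dx − Σ_{i=0}^{n} p_{B,j,i} f(x_{n,i}^{(α)})| ≤ A · 2^{−n−1} · (x_{n,j}^{(α)} + 1) · (Γ(α) / Γ(n + α + 1)) · C((n−1)/2 + α, (n+1)/2), where C(a, b) = Γ(a + 1) / (Γ(b + 1) Γ(a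 − b + 1)) is the generalized binomial coefficient. -/
/-- The generalized binomial coefficient `C(a, b) = Γ(a+1) / (Γ(b+1) Γ(a-b+1))`. -/
noncomputable def genBinom (a b : ℝ) : ℝ :=
  Real.Gamma (a + 1) / (Real.Gamma (b + 1) * Real.Gamma (a - b + 1))

open Polynomial

/-- If `u 0, u 1, …, u N` are successive derivatives on `[a, b]` and `u 0` vanishes at `N + 1`
points of `[a, b]`, then `u N` vanishes somewhere in `[a, b]`. -/
theorem exists_eq_zero_of_strictMono_zeros {a b : ℝ} (N : ℕ) (u : ℕ → ℝ → ℝ)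
    (hcont : ∀ k < N, ContinuousOn (u k) (Set.Icc a b))
    (hderiv : ∀ k < N, ∀ t ∈ Set.Ioo a b, HasDerivAt (u k) (u (k + 1) t) t)
    (z : Fin (N + 1) → ℝ) (hz : StrictMono z) (hmem : ∀ i, z i ∈ Set.Icc a b)
    (hzero : ∀ i, u 0 (z i) = 0) : ∃ ξ ∈ Set.Icc a b, u N ξ = 0 := by
  induction N generalizing u with
  | zero => exact ⟨z 0, hmem 0, hzero 0⟩
  | succ N ih =>
    have hrolle : ∀ i : Fin (N + 1),
        ∃ c ∈ Set.Ioo (z i.castSucc) (z i.succ), u 1 c = 0 := fun i =>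
      exists_hasDerivAt_eq_zero (hz i.castSucc_lt_succ)
        ((hcont 0 N.succ_pos).mono (Set.Icc_subset_Icc (hmem _).1 (hmem _).2))
        (by rw [hzero, hzero])
        (fun t ht => hderiv 0 N.succ_pos t
          ⟨(hmem _).1.trans_lt ht.1, ht.2.trans_le (hmem _).2⟩)
    choose c hc hc0 using hrolle
    refine ih (fun k => u (k + 1)) (fun k hk => hcont (k + 1) (by lia))
      (fun k hk => hderiv (k + 1) (by lia)) c ?_
      (fun i => ⟨(hmem _).1.trans (hc i).1.le, (hc i).2.le.trans (hmem _).2⟩) hc0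
    intro i j hij
    exact ((hc i).2.trans_le (hz.monotone (Fin.succ_le_castSucc_iff.2 hij))).trans (hc j).1

/-- If `f` agrees with the polynomial `Q` of degree at most `N` at `N + 1` points of `[a, b]`, then
the `N`-th derivative of `f` equals `N!` times the `N`-th coefficient of `Q` somewhere. -/
theorem exists_iteratedDerivWithin_eq_factorial_mul_coeff {a b : ℝ} (hab : a < b) {N : ℕ}
    {f : ℝ → ℝ} (hf : ContDiffOn ℝ N f (Set.Icc a b)) {Q : ℝ[X]} (hQ : Q.natDegree ≤ N)
    (S : Finset ℝ) (hS : S.card = N + 1) (hmem : ∀ t ∈ S, t ∈ Set.Icc a b)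
    (heq : ∀ t ∈ S, f t = Q.eval t) :
    ∃ ξ ∈ Set.Icc a b,
      iteratedDerivWithin N f (Set.Icc a b) ξ = (N.factorial : ℝ) * Q.coeff N := by
  have huniq := uniqueDiffOn_Icc hab
  obtain ⟨ξ, hξ, h0⟩ := exists_eq_zero_of_strictMono_zeros (a := a) (b := b) N
    (fun k t => iteratedDerivWithin k f (Set.Icc a b) t - (derivative^[k] Q).eval t)
    (fun k hk => (hf.continuousOn_iteratedDerivWithin (by exact_mod_cast hk.le) huniq).sub
      (Polynomial.continuousOn _))
    (fun k hk t ht => by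
      have hnhds : Set.Icc a b ∈ nhds t := Icc_mem_nhds ht.1 ht.2
      have hd := (hf.differentiableOn_iteratedDerivWithin (by exact_mod_cast hk) huniq t
        (Set.Ioo_subset_Icc_self ht)).hasDerivWithinAt.hasDerivAt hnhds
      rw [← iteratedDerivWithin_succ] at hd
      have hp := (derivative^[k] Q).hasDerivAt t
      rw [← Function.iterate_succ_apply' derivative k Q] at hp
      exact hd.sub hp)
    (S.orderEmbOfFin hS) (S.orderEmbOfFin hS).strictMono
    (fun i => hmem _ (S.orderEmbOfFin_mem hS i))
    (fun i => by simp [heq _ (S.orderEmbOfFin_mem hS i)])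
  refine ⟨ξ, hξ, ?_⟩
  have hconst : derivative^[N] Q = C ((N.factorial : ℝ) * Q.coeff N) := by
    rw [eq_C_of_natDegree_le_zero ((natDegree_iterate_derivative Q N).trans (by lia)),
      coeff_iterate_derivative]
    simp [Nat.descFactorial_self]
  simpa [hconst, sub_eq_zero] using h0

/-- Cauchy's error bound for polynomial interpolation. -/
theorem abs_sub_eval_le_of_interpolation {a b : ℝ} (hab : a < b) {n : ℕ} {f : ℝ → ℝ}
    (hf : ContDiffOn ℝ (n + 1 : ℕ) f (Set.Icc a b)) {A : ℝ}
    (hA : ∀ t ∈ Set.Icc a b, |iteratedDerivWithin (n + 1) f (Set.Icc a b) t| ≤ A)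
    {x : Fin (n + 1) → ℝ} (hx : Function.Injective x) (hmem : ∀ i, x i ∈ Set.Icc a b)
    {p : ℝ[X]} (hp : p.natDegree ≤ n) (hpx : ∀ i, p.eval (x i) = f (x i))
    {y : ℝ} (hy : y ∈ Set.Icc a b) :
    |f y - p.eval y| ≤ A / (n + 1).factorial * |∏ i, (y - x i)| := by
  by_cases hnode : ∃ i, y = x i
  · obtain ⟨i, rfl⟩ := hnode
    rw [hpx, Finset.prod_eq_zero (Finset.mem_univ i) (sub_self _)]
    simp
  push Not at hnode
  set P : ℝ[X] := Lagrange.nodal Finset.univ x with hP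
  have hPy : P.eval y = ∏ i, (y - x i) := Lagrange.eval_nodal
  have hPx : ∀ i, P.eval (x i) = 0 := fun i => Lagrange.eval_nodal_at_node (Finset.mem_univ i)
  have hPdeg : P.natDegree = n + 1 := by rw [hP, Lagrange.natDegree_nodal]; simp
  have hPlead : P.coeff (n + 1) = 1 := by
    rw [← hPdeg]; exact Lagrange.nodal_monic
  have hPy0 : P.eval y ≠ 0 := by
    rw [hPy]; exact Finset.prod_ne_zero_iff.2 fun i _ => sub_ne_zero.2 (hnode i)
  set c := (f y - p.eval y) / P.eval y with hc
  obtain ⟨ξ, hξ, h⟩ := exists_iteratedDerivWithin_eq_factorial_mul_coeff hab hf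
    (Q := p + C c * P)
    (natDegree_add_le_of_degree_le (by lia) ((natDegree_C_mul_le c P).trans hPdeg.le))
    (insert y (Finset.univ.image x))
    (by
      rw [Finset.card_insert_of_notMem, Finset.card_image_of_injective _ hx]
      · simp
      · simpa [eq_comm] using hnode)
    (by simpa using ⟨⟨hy.1, hy.2⟩, fun i => hmem i⟩)
    (by
      intro t ht
      simp only [Finset.mem_insert, Finset.mem_image, Finset.mem_univ, true_and] at ht
      rcases ht with rfl | ⟨i, rfl⟩
      · simp only [eval_add, eval_mul, eval_C, hc]
        field_simp
        ring
      · simp [hPx, hpx])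
  have hcoeff : (p + C c * P).coeff (n + 1) = c := by
    simp [hPlead, coeff_eq_zero_of_natDegree_lt (Nat.lt_succ_of_le hp)]
  rw [hcoeff] at h
  have hfac : (0 : ℝ) < (n + 1).factorial := by positivity
  have hbd := hA ξ hξ
  rw [h, abs_mul, abs_of_pos hfac] at hbd
  have hfy : f y - p.eval y = c * P.eval y := by rw [hc]; field_simp
  rw [hfy, abs_mul, hPy]
  gcongr
  rw [le_div_iff₀ hfac]
  linarith

/-- The standardized Gegenbauer polynomials of parameter `α`, characterized by their three-term
recurrence. -/
structure IsGegenbauer (α : ℝ) (G : ℕ → ℝ[X]) : Prop where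
  zero : G 0 = 1
  one : G 1 = X
  rec_add_two : ∀ k : ℕ, ((k : ℝ[X]) + 1 + 2 * C α) * G (k + 2) =
    2 * ((k : ℝ[X]) + 1 + C α) * X * G (k + 1) - ((k : ℝ[X]) + 1) * G k

namespace IsGegenbauer

variable {α : ℝ} {G : ℕ → ℝ[X]}

theorem derivative_identities (hG : IsGegenbauer α G) (hα : -1 / 2 < α) (n : ℕ) :
    (1 - X ^ 2) * derivative (G (n + 1)) = ((n : ℝ[X]) + 1) * (G n - X * G (n + 1)) ∧
      (1 - X ^ 2) * derivative (G n) = ((n : ℝ[X]) + 2 * C α) * (X * G n - G (n + 1)) := by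
  induction n with
  | zero =>
    simp only [zero_add, hG.zero, hG.one, derivative_X, derivative_one]
    constructor <;> · push_cast; ring
  | succ n ih =>
    obtain ⟨ihA, ihB⟩ := ih
    have hrec := hG.rec_add_two n
    refine ⟨?_, ?_⟩
    · have hd := congrArg derivative hrec
      simp only [derivative_mul, derivative_add, derivative_sub, derivative_natCast,
        derivative_one, derivative_ofNat, derivative_C, derivative_X] at hd
      have hne : ((n : ℝ[X]) + 1 + 2 * C α) ≠ 0 := by
        have h0 : ((n : ℝ) + 1 + 2 * α) ≠ 0 := by
          have : (0 : ℝ) ≤ n := n.cast_nonneg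
          linarith
        have h1 := C_ne_zero.2 h0
        simpa [C_add, C_mul, C_ofNat] using h1
      apply mul_left_cancel₀ hne
      push_cast
      linear_combination (1 - X ^ 2) * hd + 2 * ((n : ℝ[X]) + 1 + C α) * X * ihA
        - ((n : ℝ[X]) + 1) * ihB + ((n : ℝ[X]) + 2) * X * hrec
    · push_cast
      linear_combination ihA + hrec

/-- The Gegenbauer differential equation. -/
theorem differential_equation (hG : IsGegenbauer α G) (hα : -1 / 2 < α) (n : ℕ) :
    (1 - X ^ 2) * derivative (derivative (G (n + 1))) =
      (2 * C α + 1) * X * derivative (G (n + 1)) -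
        ((n : ℝ[X]) + 1) * ((n : ℝ[X]) + 1 + 2 * C α) * G (n + 1) := by
  obtain ⟨hA, hB⟩ := hG.derivative_identities hα n
  have hne : (1 - X ^ 2 : ℝ[X]) ≠ 0 := fun h => by
    simpa using congrArg (eval (0 : ℝ)) h
  have hd := congrArg derivative hA
  simp only [derivative_mul, derivative_add, derivative_sub, derivative_natCast,
    derivative_one, derivative_X, derivative_X_pow] at hd
  push_cast at hd
  simp only [C_ofNat] at hd
  apply mul_left_cancel₀ hne
  linear_combination (1 - X ^ 2) * hd + ((n : ℝ[X]) + 1) * hB -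
    ((n : ℝ[X]) + 2 * C α) * X * hA

theorem eval_zero_add_two (hG : IsGegenbauer α G) (k : ℕ) :
    ((k : ℝ) + 1 + 2 * α) * (G (k + 2)).eval 0 = -((k : ℝ) + 1) * (G k).eval 0 := by
  have h := congrArg (eval (0 : ℝ)) (hG.rec_add_two k)
  simp at h
  linarith

theorem eval_zero_odd (hG : IsGegenbauer α G) (hα : -1 / 2 < α) (m : ℕ) :
    (G (2 * m + 1)).eval 0 = 0 := by
  induction m with
  | zero => simp [hG.one]
  | succ m ih =>
    have h := hG.eval_zero_add_two (2 * m + 1)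
    rw [ih, mul_zero] at h
    refine (mul_eq_zero.1 h).resolve_left ?_
    have : (0 : ℝ) ≤ m := m.cast_nonneg
    push_cast
    linarith

/-- For `-1/2 < α < 0` an even-degree Gegenbauer polynomial attains its maximum modulus on
`[-1, 1]` at the origin. -/
theorem abs_eval_le_abs_eval_zero (hG : IsGegenbauer α G) (hα : -1 / 2 < α) (hα0 : α < 0) (m : ℕ)
    {y : ℝ} (hy : y ∈ Set.Icc (-1 : ℝ) 1) :
    |(G (2 * m + 2)).eval y| ≤ |(G (2 * m + 2)).eval 0| := by
  set g := G (2 * m + 2) with hg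
  set l : ℝ := ((2 * m + 1 : ℕ) + 1) * ((2 * m + 1 : ℕ) + 1 + 2 * α) with hl
  have hm : (0 : ℝ) ≤ m := m.cast_nonneg
  have hlpos : 0 < l := by
    rw [hl]; push_cast
    apply mul_pos <;> linarith
  have hode : ∀ t : ℝ, (1 - t ^ 2) * (derivative (derivative g)).eval t =
      (2 * α + 1) * t * (derivative g).eval t - l * g.eval t := fun t => by
    have h := congrArg (eval t) (hG.differential_equation hα (2 * m + 1))
    simpa [hl, hg] using h
  have hd0 : (derivative g).eval 0 = 0 := by
    have h := congrArg (eval (0 : ℝ)) (hG.derivative_identities hα (2 * m + 1)).1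
    simpa [hG.eval_zero_odd hα] using h
  -- the Sonin function of the differential equation
  set s : ℝ[X] := C l * g ^ 2 + (1 - X ^ 2) * (derivative g) ^ 2 with hs
  have hsd : ∀ t : ℝ, deriv (fun t => s.eval t) t = 4 * α * t * ((derivative g).eval t) ^ 2 := by
    intro t
    rw [Polynomial.deriv, hs]
    simp [derivative_pow]
    linear_combination 2 * (derivative g).eval t * hode t
  have hs0 : s.eval 0 = l * (g.eval 0) ^ 2 := by simp [hs, hd0]
  have hcont : ∀ D : Set ℝ, ContinuousOn (fun t => s.eval t) D := fun D => s.continuousOn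
  have hdiff : ∀ D : Set ℝ, DifferentiableOn ℝ (fun t => s.eval t) D :=
    fun D => s.differentiableOn
  have hle : s.eval y ≤ s.eval 0 := by
    rcases le_total 0 y with h | h
    · refine antitoneOn_of_deriv_nonpos (convex_Ici 0) (hcont _) (hdiff _) (fun t ht => ?_)
        Set.self_mem_Ici h h
      rw [interior_Ici] at ht
      rw [hsd]
      have ht' : 0 < t := ht
      have : 0 ≤ t * ((derivative g).eval t) ^ 2 := by positivity
      nlinarith
    · refine monotoneOn_of_deriv_nonneg (convex_Iic 0) (hcont _) (hdiff _) (fun t ht => ?_)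
        h Set.self_mem_Iic h
      rw [interior_Iic] at ht
      rw [hsd]
      have ht' : t < 0 := ht
      have : 0 ≤ (α * t) * ((derivative g).eval t) ^ 2 :=
        mul_nonneg (mul_nonneg_of_nonpos_of_nonpos hα0.le ht'.le) (sq_nonneg _)
      nlinarith
  have hsy : l * (g.eval y) ^ 2 ≤ s.eval y := by
    have : 0 ≤ (1 - y ^ 2) * ((derivative g).eval y) ^ 2 :=
      mul_nonneg (by nlinarith [hy.1, hy.2]) (sq_nonneg _)
    simp only [hs, eval_add, eval_mul, eval_pow, eval_C, eval_sub, eval_one, eval_X]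
    linarith
  rw [hs0] at hle
  exact sq_le_sq.1 (le_of_mul_le_mul_left (hsy.trans hle) hlpos)

theorem natDegree_le (hG : IsGegenbauer α G) (hα : -1 / 2 < α) (k : ℕ) :
    (G k).natDegree ≤ k := by
  induction k using Nat.twoStepInduction with
  | zero => simp [hG.zero]
  | one => simp [hG.one]
  | more k ih0 ih1 =>
    have h0 : ((k : ℝ) + 1 + 2 * α) ≠ 0 := by
      have : (0 : ℝ) ≤ k := k.cast_nonneg
      linarith
    have hrec : C ((k : ℝ) + 1 + 2 * α) * G (k + 2) =
        C (2 * ((k : ℝ) + 1 + α)) * (X * G (k + 1)) - C ((k : ℝ) + 1) * G k := by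
      have h := hG.rec_add_two k
      simp only [C_add, C_mul, C_1, C_ofNat, map_natCast]
      linear_combination h
    rw [← natDegree_C_mul h0, hrec]
    refine (natDegree_sub_le _ _).trans (max_le ?_ ?_)
    · refine (natDegree_C_mul_le _ _).trans (natDegree_mul_le.trans ?_)
      rw [natDegree_X]; lia
    · exact (natDegree_C_mul_le _ _).trans (by lia)

theorem coeff_succ (hG : IsGegenbauer α G) (hα : -1 / 2 < α) (k : ℕ) :
    ((k : ℝ) + 2 * α) * (G (k + 1)).coeff (k + 1) = 2 * ((k : ℝ) + α) * (G k).coeff k := by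
  cases k with
  | zero => simp [hG.zero, hG.one]
  | succ k =>
    have hrec : C ((k : ℝ) + 1 + 2 * α) * G (k + 2) =
        C (2 * ((k : ℝ) + 1 + α)) * (X * G (k + 1)) - C ((k : ℝ) + 1) * G k := by
      have h := hG.rec_add_two k
      simp only [C_add, C_mul, C_1, C_ofNat, map_natCast]
      linear_combination h
    have h := congrArg (fun p => coeff p (k + 2)) hrec
    simp only [coeff_sub, coeff_C_mul, coeff_X_mul,
      coeff_eq_zero_of_natDegree_lt ((hG.natDegree_le hα k).trans_lt (by lia : k < k + 2))] at h
    push_cast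
    linarith

theorem coeff_ne_zero (hG : IsGegenbauer α G) (hα : -1 / 2 < α) (k : ℕ) :
    (G k).coeff k ≠ 0 := by
  induction k with
  | zero => simp [hG.zero]
  | succ k ih =>
    cases k with
    | zero => simp [hG.one]
    | succ k =>
      intro h
      have h' := hG.coeff_succ hα (k + 1)
      rw [h, mul_zero] at h'
      have : (0 : ℝ) ≤ k := k.cast_nonneg
      refine mul_ne_zero (mul_ne_zero two_ne_zero ?_) ih h'.symm
      push_cast
      linarith

/-- The value at the origin of an even-degree Gegenbauer polynomial, relative to its leading
coefficient. -/
theorem eval_zero_even (hG : IsGegenbauer α G) (hα : -1 / 2 < α) (hα0 : α ≠ 0) (m : ℕ) :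
    (G (2 * m)).eval 0 * Real.Gamma (2 * m + α) * m.factorial * 4 ^ m =
      (-1) ^ m * (G (2 * m)).coeff (2 * m) * (2 * m).factorial * Real.Gamma (m + α) := by
  induction m with
  | zero => simp [hG.zero]
  | succ m ih =>
    have hm : (0 : ℝ) ≤ m := m.cast_nonneg
    have hpos : ∀ k : ℕ, (k : ℝ) + α ≠ 0 := fun k => by
      rcases Nat.eq_zero_or_pos k with rfl | hk
      · simpa using hα0
      · have : (1 : ℝ) ≤ k := by exact_mod_cast hk
        linarith
    have h2m := hpos (2 * m)
    have h2m1 := hpos (2 * m + 1)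
    have h1m := hpos m
    push_cast at h2m h2m1
    have hΓ1 : Real.Gamma (2 * (m + 1 : ℕ) + α) =
        (2 * m + 1 + α) * ((2 * m + α) * Real.Gamma (2 * m + α)) := by
      rw [← Real.Gamma_add_one h2m, show 2 * (m : ℝ) + α + 1 = 2 * m + 1 + α by ring,
        ← Real.Gamma_add_one h2m1]
      congr 1; push_cast; ring
    have hΓ2 : Real.Gamma ((m + 1 : ℕ) + α) = (m + α) * Real.Gamma (m + α) := by
      rw [← Real.Gamma_add_one h1m]
      congr 1; push_cast; ring
    have hv := hG.eval_zero_add_two (2 * m)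
    have hk1 := hG.coeff_succ hα (2 * m)
    have hk2 := hG.coeff_succ hα (2 * m + 1)
    have hq : (2 * (m : ℝ) + 1 + 2 * α) ≠ 0 := by linarith
    push_cast at hv hk1 hk2
    rw [hΓ1, hΓ2, show 2 * (m + 1) = 2 * m + 1 + 1 by ring, Nat.factorial_succ (2 * m + 1),
      Nat.factorial_succ (2 * m), Nat.factorial_succ m, pow_succ, pow_succ]
    push_cast
    apply mul_left_cancel₀ hq
    linear_combination
      (2 * m + 1 + α) * (2 * m + α) * Real.Gamma (2 * m + α) * (m + 1) * m.factorial * 4 ^ m * 4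
          * hv
        - (2 * m + 1) * (2 * m + 1 + α) * (2 * m + α) * (m + 1) * 4 * ih
        + (-1) ^ m * (2 * m + 2) * (2 * m + 1) * (2 * m).factorial * (m + α)
          * Real.Gamma (m + α) * hk2
        + (-1) ^ m * (2 * m + 2) * (2 * m + 1) * (2 * m).factorial
          * Real.Gamma (m + α) * (2 * m + 1 + α) * hk1

/-- The polynomial is its leading coefficient times the product over its roots. -/
theorem eval_eq_coeff_mul_prod (hG : IsGegenbauer α G) (hα : -1 / 2 < α) {n : ℕ}
    {x : Fin n → ℝ} (hx : Function.Injective x) (hroot : ∀ i, (G n).eval (x i) = 0) (y : ℝ) :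
    (G n).eval y = (G n).coeff n * ∏ i, (y - x i) := by
  have hK := hG.coeff_ne_zero hα n
  have hdeg : (G n).natDegree = n :=
    le_antisymm (hG.natDegree_le hα n) (le_natDegree_of_ne_zero hK)
  have hG0 : G n ≠ 0 := fun h => hK (by simp [h])
  have hnodal : (C ((G n).coeff n) * Lagrange.nodal Finset.univ x).degree = n := by
    rw [degree_C_mul hK, Lagrange.degree_nodal]; simp
  have hGdeg : (G n).degree = n := by rw [degree_eq_natDegree hG0, hdeg]
  have h : G n = C ((G n).coeff n) * Lagrange.nodal Finset.univ x := by
    refine eq_of_degree_sub_lt_of_eval_index_eq Finset.univ hx.injOn ?_ fun i _ => ?_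
    · rw [Finset.card_univ, Fintype.card_fin]
      conv_rhs => rw [← hGdeg]
      refine degree_sub_lt_left (hGdeg.trans hnodal.symm) hG0 ?_
      rw [leadingCoeff_mul, leadingCoeff_C, Lagrange.nodal_monic.leadingCoeff, mul_one,
        leadingCoeff, hdeg]
    · rw [hroot, eval_mul, Lagrange.eval_nodal_at_node (Finset.mem_univ i), mul_zero]
  conv_lhs => rw [h]
  rw [eval_mul, eval_C, Lagrange.eval_nodal]

/-- Sup-norm bound for the monic Gegenbauer polynomial of positive even degree. -/
theorem abs_prod_sub_le (hG : IsGegenbauer α G) (hα : -1 / 2 < α) (hα0 : α < 0) (m : ℕ)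
    {x : Fin (2 * m + 2) → ℝ} (hx : Function.Injective x)
    (hroot : ∀ i, (G (2 * m + 2)).eval (x i) = 0) {y : ℝ} (hy : y ∈ Set.Icc (-1 : ℝ) 1) :
    |∏ i, (y - x i)| ≤ (2 * m + 2).factorial * Real.Gamma (m + 1 + α) /
      (Real.Gamma (2 * m + 2 + α) * (m + 1).factorial * 4 ^ (m + 1)) := by
  have hm : (0 : ℝ) ≤ m := m.cast_nonneg
  have hK := hG.coeff_ne_zero hα (2 * m + 2)
  have hmax := hG.abs_eval_le_abs_eval_zero hα hα0 m hy
  rw [hG.eval_eq_coeff_mul_prod hα hx hroot y, abs_mul] at hmax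
  have hval := congrArg abs (hG.eval_zero_even hα hα0.ne (m + 1))
  have hΓ1 : 0 < Real.Gamma (2 * m + 2 + α) := Real.Gamma_pos_of_pos (by linarith)
  have hΓ2 : 0 < Real.Gamma (m + 1 + α) := Real.Gamma_pos_of_pos (by linarith)
  rw [show 2 * (m + 1) = 2 * m + 2 by ring] at hval
  push_cast at hval
  rw [show 2 * ((m : ℝ) + 1) + α = 2 * m + 2 + α by ring] at hval
  simp only [abs_mul, abs_pow, abs_neg, abs_one, one_pow, one_mul, abs_of_pos hΓ1,
    abs_of_pos hΓ2, Nat.abs_cast, Nat.abs_ofNat] at hval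
  rw [le_div_iff₀ (by positivity)]
  refine le_of_mul_le_mul_left ?_ (abs_pos.2 hK)
  calc _ = (|(G (2 * m + 2)).coeff (2 * m + 2)| * |∏ i, (y - x i)|) *
        (Real.Gamma (2 * m + 2 + α) * (m + 1).factorial * 4 ^ (m + 1)) := by ring
    _ ≤ |(G (2 * m + 2)).eval 0| *
        (Real.Gamma (2 * m + 2 + α) * (m + 1).factorial * 4 ^ (m + 1)) := by gcongr
    _ = _ := by linear_combination hval

end IsGegenbauer

/-- **Error bound for the barycentric Gegenbauer quadrature, case `-1/2 < α < 0`, `n` odd.**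
With Gegenbauer–Gauss points `x 0 < ⋯ < x n`, Lagrange basis polynomials `L i`,
`p_{B,j,i} = ∫_{-1}^{x j} (L i)(t) dt`, and `f ∈ C^{n+1}[-1,1]` with
`‖f^{(n+1)}‖_∞ ≤ A`, for every `j`:
`|∫_{-1}^{x j} f - ∑ i, p_{B,j,i} f(x i)|
   ≤ A 2^{-n-1} (x j + 1) (Γ(α)/Γ(n+α+1)) C((n-1)/2 + α, (n+1)/2)`. -/
theorem barycentric_gegenbauer_quadrature_bound_neg_alpha_odd
    (α : ℝ) (hα1 : -1/2 < α) (hα2 : α < 0) (n : ℕ) (hn : 1 ≤ n) (hodd : Odd n)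
    (G : ℕ → Polynomial ℝ)
    (hG0 : G 0 = 1) (hG1 : G 1 = Polynomial.X)
    (hGrec : ∀ k : ℕ, 1 ≤ k →
      Polynomial.C ((k : ℝ) + 2 * α) * G (k + 1) =
        Polynomial.C (2 * ((k : ℝ) + α)) * (Polynomial.X * G k) -
          Polynomial.C (k : ℝ) * G (k - 1))
    (x : Fin (n + 1) → ℝ)
    (hx_mono : StrictMono x)
    (hx_mem : ∀ i, x i ∈ Set.Ioo (-1 : ℝ) 1)
    (hx_root : ∀ y : ℝ, (G (n + 1)).eval y = 0 ↔ ∃ i, y = x i)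
    (L : Fin (n + 1) → Polynomial ℝ)
    (hL_deg : ∀ k, (L k).natDegree ≤ n)
    (hL_eval : ∀ k j, (L k).eval (x j) = if j = k then (1 : ℝ) else 0)
    (f : ℝ → ℝ)
    (hf : ContDiffOn ℝ (n + 1 : ℕ) f (Set.Icc (-1 : ℝ) 1))
    (A : ℝ) (hA : 0 < A)
    (hbound : ∀ t ∈ Set.Icc (-1 : ℝ) 1,
      |iteratedDerivWithin (n + 1) f (Set.Icc (-1 : ℝ) 1) t| ≤ A) :
    ∀ j : Fin (n + 1),
      |(∫ t in (-1 : ℝ)..(x j), f t) -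
          ∑ i : Fin (n + 1), (∫ t in (-1 : ℝ)..(x j), (L i).eval t) * f (x i)| ≤
        A * (2 : ℝ) ^ (-(n : ℤ) - 1) * (x j + 1) *
          (Real.Gamma α / Real.Gamma ((n : ℝ) + α + 1)) *
            genBinom (((n : ℝ) - 1) / 2 + α) (((n : ℝ) + 1) / 2) := by
  intro j
  obtain ⟨m, rfl⟩ := hodd
  have hm : (0 : ℝ) ≤ m := m.cast_nonneg
  have hG : IsGegenbauer α G := ⟨hG0, hG1, fun k => by
    have h := hGrec (k + 1) (by lia)
    simp only [Nat.cast_add, Nat.cast_one, C_add, C_mul, C_1, C_ofNat, map_natCast,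
      Nat.add_sub_cancel] at h
    linear_combination h⟩
  have hmem : ∀ i, x i ∈ Set.Icc (-1 : ℝ) 1 := fun i => Set.Ioo_subset_Icc_self (hx_mem i)
  set p : ℝ[X] := ∑ i, C (f (x i)) * L i with hp
  have hpdeg : p.natDegree ≤ 2 * m + 1 :=
    natDegree_sum_le_of_forall_le _ _ fun i _ => (natDegree_C_mul_le _ _).trans (hL_deg i)
  have hpx : ∀ i, p.eval (x i) = f (x i) := fun i => by
    simp [hp, eval_finsetSum, hL_eval]
  set M : ℝ := A * (Real.Gamma (m + 1 + α) /
    (Real.Gamma (2 * m + 2 + α) * (m + 1).factorial * 4 ^ (m + 1))) with hM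
  have herr : ∀ y ∈ Set.Icc (-1 : ℝ) 1, |f y - p.eval y| ≤ M := fun y hy => by
    refine (abs_sub_eval_le_of_interpolation (by norm_num) hf hbound hx_mono.injective hmem
      hpdeg hpx hy).trans ?_
    have hprod := hG.abs_prod_sub_le hα1 hα2 m hx_mono.injective
      (fun i => (hx_root _).2 ⟨i, rfl⟩) hy
    refine (mul_le_mul_of_nonneg_left hprod (by positivity)).trans_eq ?_
    rw [hM]
    have : ((2 * m + 1 + 1).factorial : ℝ) ≠ 0 := by positivity
    field_simp
  have hsub : Set.uIcc (-1 : ℝ) (x j) ⊆ Set.Icc (-1 : ℝ) 1 := by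
    rw [Set.uIcc_of_le (hmem j).1]
    exact Set.Icc_subset_Icc le_rfl (hmem j).2
  have hint : ∀ q : ℝ[X], IntervalIntegrable (fun t => q.eval t) MeasureTheory.volume (-1) (x j) :=
    fun q => q.continuous.intervalIntegrable _ _
  have hfint : IntervalIntegrable f MeasureTheory.volume (-1) (x j) :=
    (hf.continuousOn.mono hsub).intervalIntegrable
  have hpint : ∫ t in (-1 : ℝ)..(x j), p.eval t =
      ∑ i, (∫ t in (-1 : ℝ)..(x j), (L i).eval t) * f (x i) := by
    simp only [hp, eval_finsetSum, eval_mul, eval_C]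
    rw [intervalIntegral.integral_finsetSum fun i _ => (hint (L i)).const_mul _]
    exact Finset.sum_congr rfl fun i _ => by
      rw [intervalIntegral.integral_const_mul, mul_comm]
  rw [← hpint, ← intervalIntegral.integral_sub hfint (hint p)]
  refine (intervalIntegral.norm_integral_le_of_norm_le_const (f := fun t => f t - p.eval t) (C := M)
    fun t ht => herr t (hsub (Set.uIoc_subset_uIcc ht))).trans_eq ?_
  rw [abs_of_nonneg (by linarith [(hmem j).1]), hM, genBinom]
  have hΓα : Real.Gamma α ≠ 0 := by
    refine Real.Gamma_ne_zero fun k hk => ?_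
    rcases Nat.eq_zero_or_pos k with rfl | hk'
    · simp at hk; linarith
    · have : (1 : ℝ) ≤ k := by exact_mod_cast hk'
      linarith
  have hpow : (2 : ℝ) ^ (-((2 * m + 1 : ℕ) : ℤ) - 1) = (4 ^ (m + 1))⁻¹ := by
    rw [show (4 : ℝ) = 2 ^ 2 by norm_num, ← pow_mul, ← zpow_natCast, ← zpow_neg]
    congr 1
  have hfact : Real.Gamma ((((2 * m + 1 : ℕ) : ℝ) + 1) / 2 + 1) = (m + 1).factorial := by
    rw [← Real.Gamma_nat_eq_factorial]
    congr 1; push_cast; ring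
  rw [hpow, hfact]
  have e1 : ((2 * m + 1 : ℕ) : ℝ) + α + 1 = 2 * m + 2 + α := by push_cast; ring
  have e2 : (((2 * m + 1 : ℕ) : ℝ) - 1) / 2 + α + 1 = m + 1 + α := by push_cast; ring
  have e3 : (((2 * m + 1 : ℕ) : ℝ) - 1) / 2 + α - (((2 * m + 1 : ℕ) : ℝ) + 1) / 2 + 1 = α := by
    push_cast; ring
  rw [e1, e2, e3]
  have hΓ1 : Real.Gamma (2 * m + 2 + α) ≠ 0 := (Real.Gamma_pos_of_pos (by linarith)).ne'
  field_simp
  ring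
end
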